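/- For any even integer k ≥ 4, the Eisenstein series E_k(τ) = -B_k/k! + (2/(k-1)!) Σ_{n≥1} n^{k-1} q^n/(1-q^n) (with q = e^{2πiτ}) satisfies E_k(γτ) = (cτ+d)^k E_k(τ) for every γ = [[a,b],[c,d]] ∈ SL(2,ℤ), i.e., E_k is a modular form of weight k. -/

import Mathlib

open Complex

/-- The Eisenstein series `E_k(τ) = -B_k/k! + (2/(k-1)!) ∑_{n≥1} n^{k-1} q^n/(1-q^n)`
with `q = e^{2πiτ}` and `B_k` the k-th Bernoulli number (convention `z/(e^z-1) = ∑ B_k z^k/k!`). -/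
noncomputable def EisensteinE (k : ℕ) (τ : ℂ) : ℂ :=
  -((bernoulli k : ℚ) : ℂ) / (Nat.factorial k) +
    (2 / (Nat.factorial (k - 1))) *
      ∑' n : ℕ, ((n : ℂ) + 1) ^ (k - 1) * Complex.exp (2 * Real.pi * I * τ) ^ (n + 1) /
        (1 - Complex.exp (2 * Real.pi * I * τ) ^ (n + 1))

open scoped ArithmeticFunction.sigma

theorem bernoulli_ne_zero_of_even {k : ℕ} (hke : Even k) : bernoulli k ≠ 0 := by
  rcases eq_or_ne k 0 with rfl | hk0
  · simp
  obtain ⟨m, rfl⟩ := hke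
  rw [← two_mul] at hk0 ⊢
  have hm : m ≠ 0 := by rintro rfl; simp at hk0
  intro hB
  have hζ : riemannZeta (2 * m : ℂ) ≠ 0 := by
    apply riemannZeta_ne_zero_of_one_le_re
    norm_cast
    lia
  apply hζ
  rw [riemannZeta_two_mul_nat hm, hB]
  simp

/-- On the upper half-plane, `EisensteinE k` is `-B_k / k!` times Mathlib's normalised level one
Eisenstein series of weight `k`. -/
theorem EisensteinE_eq_mul_E {k : ℕ} (hke : Even k) (hk : 3 ≤ k) (z : UpperHalfPlane) :
    EisensteinE k z =
      -((bernoulli k : ℚ) : ℂ) / (Nat.factorial k) * ModularForm.E hk z := by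
  have hB : ((bernoulli k : ℚ) : ℂ) ≠ 0 := by
    exact_mod_cast bernoulli_ne_zero_of_even hke
  have hfac : (Nat.factorial k : ℂ) = k * Nat.factorial (k - 1) := by
    exact_mod_cast (Nat.mul_factorial_pred (by lia)).symm
  have hk0 : (k : ℂ) ≠ 0 := by exact_mod_cast (by lia : k ≠ 0)
  have hf0 : (Nat.factorial (k - 1) : ℂ) ≠ 0 := by exact_mod_cast Nat.factorial_ne_zero _
  have hsum := tsum_pow_div_one_sub_eq_tsum_sigma
    (UpperHalfPlane.norm_exp_two_pi_I_lt_one z) (k - 1)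
  rw [tsum_pnat_eq_tsum_succ (f := fun n : ℕ ↦ (n : ℂ) ^ (k - 1) *
    Complex.exp (2 * Real.pi * I * z) ^ n / (1 - Complex.exp (2 * Real.pi * I * z) ^ n))] at hsum
  push_cast at hsum
  rw [EisensteinE, EisensteinSeries.q_expansion_bernoulli hk hke z, hsum, hfac]
  simp only [zpow_natCast]
  field_simp
  ring

/-- For any even `k ≥ 4`, `E_k` is a modular form of weight `k`:
`E_k(γτ) = (cτ+d)^k E_k(τ)` for every `γ = [[a,b],[c,d]] ∈ SL(2,ℤ)` and `τ ∈ ℍ`. -/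
theorem EisensteinE_modular (k : ℕ) (hke : Even k) (hk : 4 ≤ k)
    (a b c d : ℤ) (hdet : a * d - b * c = 1) (τ : ℂ) (hτ : 0 < τ.im) :
    EisensteinE k (((a : ℂ) * τ + b) / ((c : ℂ) * τ + d)) =
      ((c : ℂ) * τ + d) ^ k * EisensteinE k τ := by
  let z : UpperHalfPlane := ⟨τ, hτ⟩
  let γ : Matrix.SpecialLinearGroup (Fin 2) ℤ :=
    ⟨!![a, b; c, d], by rw [Matrix.det_fin_two_of, hdet]⟩
  have hk3 : 3 ≤ k := by lia
  have hγ : ((a : ℂ) * τ + b) / ((c : ℂ) * τ + d) = (γ • z : UpperHalfPlane) := by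
    rw [UpperHalfPlane.coe_specialLinearGroup_apply]
    simp [γ, z]
  have hE : ModularForm.E hk3 (γ • z) = ((c : ℂ) * τ + d) ^ k * ModularForm.E hk3 z := by
    have h := SlashInvariantForm.slash_action_eqn' (ModularForm.E hk3)
      (MonoidHom.mem_range.mpr ⟨γ, rfl⟩ : Matrix.SpecialLinearGroup.mapGL ℝ γ ∈ _) z
    rw [← MulAction.compHom_smul_def] at h
    have hc : Matrix.SpecialLinearGroup.mapGL ℝ γ 1 0 = (c : ℝ) := rfl
    have hd : Matrix.SpecialLinearGroup.mapGL ℝ γ 1 1 = (d : ℝ) := rfl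
    rw [hc, hd] at h
    exact_mod_cast h
  rw [hγ, EisensteinE_eq_mul_E hke hk3, hE, show τ = (z : ℂ) from rfl,
    EisensteinE_eq_mul_E hke hk3]
  ring
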